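/- Fix reals α, β with 0 ≤ α < 1 and β > 2, suppose D(a) is bounded, and let L = max D(a). Let Q = {n ∈ ℕ : k₁((b_1,…,b_{n−1})) = 0 and k₁((b_1,…,b_n)) = 0} (with k₁(empty word) = 0) and define c ∈ {0,…,ℓ}^ℕ by c_n = 1 if n ∈ Q and c_n = b_n otherwise. Then either there exists a closed σ-invariant subset Σ′ ⊆ Σ with c ∈ Σ′ whose language has specification, or b_i = c_i for all i > L + 1. -/

import Mathlib

noncomputable section

namespace IntermediateBeta

/-- The intermediate beta transformation `x ↦ βx + α mod 1`. -/
def F (α β : ℝ) (x : ℝ) : ℝ := Int.fract (β * x + α)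

/-- The digit sequence of a point: `Om α β x n` is the index `i` with `F^[n] x ∈ J_i`.
For `y ∈ [0,1)` we have `y ∈ J_i ↔ ⌊β y + α⌋ = i`. -/
def Om (α β : ℝ) (x : ℝ) : ℕ → ℕ := fun n => (⌊β * ((F α β)^[n] x) + α⌋).toNat

/-- `ℓ = ⌈α + β⌉ - 1`. -/
def ell (α β : ℝ) : ℕ := ⌈α + β⌉₊ - 1

/-- The subshift `Σ`: closure (in the product topology) of the set of digit sequences
of points of `[0,1)`. -/
def Sig (α β : ℝ) : Set (ℕ → ℕ) := closure (Om α β '' Set.Ico (0 : ℝ) 1)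

/-- The shift map. -/
def shift (x : ℕ → ℕ) : ℕ → ℕ := fun n => x (n + 1)

/-- Lexicographic order on one-sided sequences. -/
def lexLe (x y : ℕ → ℕ) : Prop := x = y ∨ ∃ k, (∀ i < k, x i = y i) ∧ x k < y k

/-- The language of a subset `S` of the full shift: the finite words occurring as
initial segments of elements of `S`. -/
def langOf (S : Set (ℕ → ℕ)) (w : List ℕ) : Prop :=
  ∃ x ∈ S, ∀ i : Fin w.length, x i = w.get i

/-- Membership in the language `𝓛` of the subshift `Σ`. -/
def inLang (α β : ℝ) (w : List ℕ) : Prop := langOf (Sig α β) w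

/-- The tail segment of `w` of length `k` agrees with the initial segment of `s`
of length `k`. -/
def tailAgrees (s : ℕ → ℕ) (w : List ℕ) (k : ℕ) : Prop :=
  k ≤ w.length ∧ ∀ i < k, w.getD (w.length - k + i) 0 = s i

/-- `kmax s w` is the length of the longest tail segment of `w` agreeing with an
initial segment of `s` (`k₁(w)` when `s = a`, `k₂(w)` when `s = b`). -/
def kmax (s : ℕ → ℕ) (w : List ℕ) : ℕ := sSup {k | tailAgrees s w k}

/-- `D a b` is the set of lengths `n` such that the initial segment of `b` of
length `n` occurs somewhere in `a`.  Thus `D a b` is the set `𝖣(a)` of the paper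
and `D b a` is `𝖣(b)`. -/
def D (a b : ℕ → ℕ) : Set ℕ := {n | ∃ j, ∀ i < n, b i = a (j + i)}

/-- Gluing of the words `w 0, v 0, w 1, v 1, …, v (n-1), w n`. -/
def glue {n : ℕ} (w : Fin (n + 1) → List ℕ) (v : Fin n → List ℕ) : List ℕ :=
  (List.ofFn fun i : Fin n => w i.castSucc ++ v i).flatten ++ w (Fin.last n)

/-- A collection `G` of words inside the language `lang` has specification: there
is `τ ∈ ℕ` such that any finite list of words of `G` can be glued, with gluing
words from `lang` of length `τ`, into a word of `lang`. -/
def HasSpec (lang G : List ℕ → Prop) : Prop :=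
  ∃ τ : ℕ, 1 ≤ τ ∧ ∀ n : ℕ, ∀ w : Fin (n + 1) → List ℕ, (∀ i, G (w i)) →
    ∃ v : Fin n → List ℕ, (∀ i, (v i).length = τ ∧ lang (v i)) ∧ lang (glue w v)

/-- The initial segment of a sequence, as a finite word. -/
def pre (s : ℕ → ℕ) (n : ℕ) : List ℕ := List.ofFn fun i : Fin n => s i

/-- Lexicographic order for finite words (of equal length). -/
def wordLe (u v : List ℕ) : Prop :=
  u = v ∨ ∃ k, (∀ i < k, u.getD i 0 = v.getD i 0) ∧ u.getD k 0 < v.getD k 0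

/-- Concatenation of a finite word with an infinite sequence. -/
def wcat (w : List ℕ) (x : ℕ → ℕ) : ℕ → ℕ := fun n =>
  if h : n < w.length then w.get ⟨n, h⟩ else x (n - w.length)

/-- The sequence `c` obtained from `b` by changing to `1` every letter of `b`
corresponding to a flat of the path of `b` in the Hofbauer-type graph (an index
`n` lies in `Q` iff `k₁(b_1…b_{n-1}) = 0` and `k₁(b_1…b_n) = 0`). -/
def cseq (a b : ℕ → ℕ) : ℕ → ℕ := fun n =>
  if kmax a (pre b n) = 0 ∧ kmax a (pre b (n + 1)) = 0 then 1 else b n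

/-- Every shift of `x` is at least `a`. -/
def LoP (a x : ℕ → ℕ) : Prop := ∀ m k, (∀ i < k, x (m + i) = a i) → a k ≤ x (m + k)

/-- Every shift of `x` is at most `b`. -/
def HiP (b x : ℕ → ℕ) : Prop := ∀ m k, (∀ i < k, x (m + i) = b i) → x (m + k) ≤ b k

/-- The subshift in which the word `b_1 … b_{r+1}` is moreover forbidden. -/
def SS (a b : ℕ → ℕ) (r : ℕ) : Set (ℕ → ℕ) :=
  {x | LoP a x ∧ HiP b x ∧ ∀ m, ∃ i < r + 1, x (m + i) ≠ b i}

/-- No nonempty suffix of the first `p` letters of `z` is a prefix of `s`. -/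
def NoM (s z : ℕ → ℕ) (p : ℕ) : Prop := ∀ m < p, ¬ ∀ i < p - m, z (m + i) = s i

/-- Finite version of membership in `SS`. -/
structure GoodP (a b : ℕ → ℕ) (r : ℕ) (z : ℕ → ℕ) (p : ℕ) : Prop where
  lo : ∀ m k, m + k < p → (∀ i < k, z (m + i) = a i) → a k ≤ z (m + k)
  hi : ∀ m k, m + k < p → (∀ i < k, z (m + i) = b i) → z (m + k) ≤ b k
  no : ∀ m, m + (r + 1) ≤ p → ∃ i < r + 1, z (m + i) ≠ b i

/-- Concatenation of the first `p` letters of `z` with `y`. -/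
def cc (z : ℕ → ℕ) (p : ℕ) (y : ℕ → ℕ) : ℕ → ℕ := fun i => if i < p then z i else y (i - p)

lemma lexLe_iff (x y : ℕ → ℕ) : lexLe x y ↔ ∀ k, (∀ i < k, x i = y i) → x k ≤ y k := by
  constructor
  · rintro (rfl | ⟨j, h1, h2⟩) k hk
    · exact le_rfl
    · rcases lt_trichotomy k j with h | h | h
      · exact (h1 k h).le
      · subst h; exact h2.le
      · exact absurd (hk j h) h2.ne
  · intro h
    by_cases hxy : x = y
    · exact Or.inl hxy
    · right
      have hex : ∃ k, x k ≠ y k := by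
        by_contra hc
        push Not at hc
        exact hxy (funext hc)
      classical
      refine ⟨Nat.find hex, ?_, ?_⟩
      · intro i hi
        have := Nat.find_min hex hi
        push Not at this
        exact this
      · refine lt_of_le_of_ne (h _ ?_) (Nat.find_spec hex)
        intro i hi
        have := Nat.find_min hex hi
        push Not at this
        exact this

lemma mem_closure_seq (S : Set (ℕ → ℕ)) (x : ℕ → ℕ) :
    x ∈ closure S ↔ ∀ n, ∃ y ∈ S, ∀ i < n, y i = x i := by
  constructor
  · intro hx n
    rw [mem_closure_iff] at hx
    have ho : IsOpen {z : ℕ → ℕ | ∀ i < n, z i = x i} := by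
      have : {z : ℕ → ℕ | ∀ i < n, z i = x i}
          = ⋂ i ∈ Finset.range n, (fun z : ℕ → ℕ => z i) ⁻¹' {x i} := by
        ext z; simp
      rw [this]
      refine isOpen_biInter_finset ?_
      intro i _
      exact (isOpen_discrete _).preimage (continuous_apply i)
    obtain ⟨y, hy1, hy2⟩ := hx _ ho (fun i _ => rfl)
    exact ⟨y, hy2, hy1⟩
  · intro h
    choose y hy hyx using h
    refine mem_closure_of_tendsto (f := y) (b := Filter.atTop) ?_ (Filter.Eventually.of_forall hy)
    rw [tendsto_pi_nhds]
    intro i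
    refine tendsto_const_nhds.congr' ?_
    filter_upwards [Filter.eventually_gt_atTop i] with n hn
    exact (hyx n i hn).symm

section Dyn
variable {α β : ℝ}

lemma F_mem (x : ℝ) : F α β x ∈ Set.Ico (0 : ℝ) 1 :=
  ⟨Int.fract_nonneg _, Int.fract_lt_one _⟩

lemma Om_succ (x : ℝ) (n : ℕ) : Om α β x (n + 1) = Om α β (F α β x) n := by
  simp [Om, Function.iterate_succ_apply]

lemma Om_zero (hα0 : 0 ≤ α) (hβ : 2 < β) (x : ℝ) (hx : x ∈ Set.Ico (0 : ℝ) 1) :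
    ((Om α β x 0 : ℕ) : ℝ) + F α β x = β * x + α := by
  have h0 : 0 ≤ β * x + α := by have := hx.1; positivity
  have h1 : 0 ≤ ⌊β * x + α⌋ := Int.floor_nonneg.mpr h0
  have h2 : ((Om α β x 0 : ℕ) : ℝ) = ((⌊β * x + α⌋ : ℤ) : ℝ) := by
    have : ((Om α β x 0 : ℕ) : ℤ) = ⌊β * x + α⌋ := by
      simp [Om, Int.toNat_of_nonneg h1]
    rw [← this]; simp
  rw [h2]
  exact Int.floor_add_fract _

lemma Om_lt (hα0 : 0 ≤ α) (hβ : 2 < β) (k : ℕ) : ∀ x ∈ Set.Ico (0 : ℝ) 1,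
    ∀ y ∈ Set.Ico (0 : ℝ) 1, (∀ i < k, Om α β x i = Om α β y i) →
    Om α β x k < Om α β y k → x < y := by
  induction k with
  | zero =>
    intro x hx y hy _ h
    have e1 := Om_zero hα0 hβ x hx
    have e2 := Om_zero hα0 hβ y hy
    have f1 := (F_mem (α := α) (β := β) x).2
    have f2 := (F_mem (α := α) (β := β) y).1
    have h' : ((Om α β x 0 : ℕ) : ℝ) + 1 ≤ (Om α β y 0 : ℕ) := by exact_mod_cast h
    nlinarith
  | succ k ih =>
    intro x hx y hy h h2
    have e1 := Om_zero hα0 hβ x hx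
    have e2 := Om_zero hα0 hβ y hy
    rw [Om_succ, Om_succ] at h2
    have := ih _ (F_mem x) _ (F_mem y) (fun i hi => by
      have := h (i + 1) (by omega)
      rwa [Om_succ, Om_succ] at this) h2
    have h0 := h 0 (by omega)
    rw [h0] at e1
    nlinarith

lemma Om_pre (hα1 : α < 1) (hβ : 2 < β) (y : ℝ) (hy : y ∈ Set.Ico (0 : ℝ) 1) (d : ℕ)
    (h1 : α ≤ d + y) (h2 : d + y < α + β) :
    ∃ x ∈ Set.Ico (0 : ℝ) 1, Om α β x 0 = d ∧ F α β x = y := by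
  have hb : (0 : ℝ) < β := by linarith
  refine ⟨(d + y - α) / β, ⟨?_, ?_⟩, ?_, ?_⟩
  · apply div_nonneg <;> linarith
  · rw [div_lt_one hb]; linarith
  all_goals
    have e : β * ((d + y - α) / β) + α = d + y := by field_simp; ring
  · have : ⌊(d : ℝ) + y⌋ = d := by
      rw [Int.floor_eq_iff]
      push_cast
      constructor <;> linarith [hy.1, hy.2]
    simp only [Om, Function.iterate_zero, id_eq, e, this, Int.toNat_natCast]
  · simp only [F, e]
    rw [Int.fract_eq_iff]
    exact ⟨hy.1, hy.2, d, by simp⟩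

lemma Om_shift (x : ℝ) (m : ℕ) : ∃ y, (x ∈ Set.Ico (0 : ℝ) 1 → y ∈ Set.Ico (0 : ℝ) 1) ∧
    ∀ n, Om α β x (m + n) = Om α β y n := by
  induction m generalizing x with
  | zero => exact ⟨x, id, fun n => by simp⟩
  | succ m ih =>
    obtain ⟨y, hy, h⟩ := ih (F α β x)
    refine ⟨y, fun _ => hy (F_mem x), fun n => ?_⟩
    rw [← h n, ← Om_succ]
    congr 1
    omega

lemma Sig_lo (hα0 : 0 ≤ α) (hβ : 2 < β) (x : ℕ → ℕ) (hx : x ∈ Sig α β) :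
    LoP (Om α β 0) x := by
  intro m k h
  obtain ⟨_, ⟨t, ht, rfl⟩, hz⟩ := (mem_closure_seq _ _).1 hx (m + k + 1)
  obtain ⟨y, hy, hyt⟩ := Om_shift (α := α) (β := β) t m
  by_contra hc
  push Not at hc
  have := Om_lt hα0 hβ k y (hy ht) 0 (by simp) (fun i hi => by
    rw [← hyt, hz _ (by omega), h i hi]) (by rw [← hyt, hz _ (by omega)]; exact hc)
  exact absurd (hy ht).1 (by linarith)

lemma Sig_shift (x : ℕ → ℕ) (hx : x ∈ Sig α β) (m : ℕ) : (fun n => x (m + n)) ∈ Sig α β := by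
  unfold Sig
  rw [mem_closure_seq]
  intro n
  obtain ⟨_, ⟨t, ht, rfl⟩, hz⟩ := (mem_closure_seq _ _).1 hx (m + n)
  obtain ⟨y, hy, hyt⟩ := Om_shift (α := α) (β := β) t m
  refine ⟨_, ⟨y, hy ht, rfl⟩, fun i hi => ?_⟩
  rw [← hyt, hz _ (by omega)]

lemma Sig_hi (b : ℕ → ℕ) (hbsup : ∀ y ∈ Sig α β, lexLe y b) (x : ℕ → ℕ) (hx : x ∈ Sig α β) :
    HiP b x := by
  intro m k h
  exact (lexLe_iff _ _).1 (hbsup _ (Sig_shift x hx m)) k h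

lemma first_diff (x y : ℕ → ℕ) (n : ℕ) (h : ¬ ∀ i < n, x i = y i) :
    ∃ k < n, (∀ i < k, x i = y i) ∧ x k ≠ y k := by
  classical
  have hex : ∃ k, k < n ∧ x k ≠ y k := by
    push Not at h
    obtain ⟨k, h1, h2⟩ := h
    exact ⟨k, h1, h2⟩
  refine ⟨Nat.find hex, (Nat.find_spec hex).1, fun i hi => ?_, (Nat.find_spec hex).2⟩
  have := Nat.find_min hex hi
  have h2 := (Nat.find_spec hex).1
  by_contra hc
  exact this ⟨by omega, hc⟩

lemma realize (hα0 : 0 ≤ α) (hα1 : α < 1) (hβ : 2 < β) (b : ℕ → ℕ) (hb : b ∈ Sig α β)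
    (n : ℕ) : ∀ x : ℕ → ℕ, LoP (Om α β 0) x → HiP b x →
    ∃ y ∈ Set.Ico (0 : ℝ) 1, ∀ i < n, Om α β y i = x i := by
  induction n with
  | zero => intro x _ _; exact ⟨0, by simp, fun i hi => by omega⟩
  | succ n ih =>
    intro x hlo hhi
    by_cases h0 : ∀ i < n + 1, x i = Om α β 0 i
    · exact ⟨0, by simp, fun i hi => (h0 i hi).symm⟩
    obtain ⟨_, ⟨t, ht, rfl⟩, hz⟩ := (mem_closure_seq _ _).1 hb (n + 1)
    by_cases h1 : ∀ i < n + 1, x i = b i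
    · exact ⟨t, ht, fun i hi => by rw [h1 i hi, hz i hi]⟩
    obtain ⟨y, hy, hyx⟩ := ih (fun i => x (i + 1))
      (fun m k h => by
        have := hlo (m + 1) k (fun i hi => by rw [← h i hi]; congr 1; omega)
        rwa [show m + 1 + k = m + k + 1 by omega] at this)
      (fun m k h => by
        have := hhi (m + 1) k (fun i hi => by rw [← h i hi]; congr 1; omega)
        rwa [show m + 1 + k = m + k + 1 by omega] at this)
    have ea := Om_zero hα0 hβ 0 (by simp)
    have eb := Om_zero hα0 hβ t ht
    have eF0 : F α β 0 = α := by simp [F, Int.fract_eq_self.mpr ⟨hα0, hα1⟩]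
    have ea0 : Om α β 0 0 = 0 := by
      rw [eF0] at ea
      have : ((Om α β 0 0 : ℕ) : ℝ) = 0 := by linarith
      exact_mod_cast this
    have htb : β * t < β := by nlinarith [ht.2]
    obtain ⟨z, hz1, hz2, hz3⟩ := Om_pre (α := α) (β := β) hα1 hβ y hy (x 0) (by
      obtain ⟨k, hk, hk1, hk2⟩ := first_diff _ _ _ h0
      rcases Nat.eq_zero_or_pos k with rfl | hkp
      · rw [ea0] at hk2
        have : (1 : ℝ) ≤ x 0 := by exact_mod_cast Nat.one_le_iff_ne_zero.mpr hk2
        linarith [hy.1]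
      · obtain ⟨j, rfl⟩ : ∃ j, k = j + 1 := ⟨k - 1, by omega⟩
        have h3 := hlo 0 (j + 1) (fun i hi => by rw [Nat.zero_add]; exact hk1 i hi)
        rw [Nat.zero_add] at h3
        have := Om_lt hα0 hβ j (F α β 0) (F_mem 0) y hy (fun i hi => by
          rw [← Om_succ, hyx i (by omega), hk1 (i + 1) (by omega)])
          (by rw [← Om_succ, hyx j (by omega)]; exact lt_of_le_of_ne h3 (Ne.symm hk2))
        rw [eF0] at this
        have h5 : (0 : ℝ) ≤ x 0 := by positivity
        linarith) (by
      obtain ⟨k, hk, hk1, hk2⟩ := first_diff _ _ _ h1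
      have h3 := hhi 0 k (fun i hi => by rw [Nat.zero_add]; exact hk1 i hi)
      rw [Nat.zero_add] at h3
      have h4 := lt_of_le_of_ne h3 hk2
      have f0 := (F_mem (α := α) (β := β) t).1
      rw [hz 0 (by omega)] at eb
      rcases Nat.eq_zero_or_pos k with rfl | hkp
      · have : (x 0 : ℝ) + 1 ≤ b 0 := by exact_mod_cast h4
        linarith [hy.2]
      · obtain ⟨j, rfl⟩ : ∃ j, k = j + 1 := ⟨k - 1, by omega⟩
        have := Om_lt hα0 hβ j y hy (F α β t) (F_mem t) (fun i hi => by
          rw [← Om_succ, hyx i (by omega), hz (i + 1) (by omega), hk1 (i + 1) (by omega)])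
          (by rw [← Om_succ, hyx j (by omega), hz _ hk]; exact h4)
        rw [hk1 0 (by omega)]
        linarith)
    refine ⟨z, hz1, fun i hi => ?_⟩
    rcases i with _ | i
    · exact hz2
    · rw [Om_succ, hz3, hyx i (by omega)]

lemma mem_Sig (hα0 : 0 ≤ α) (hα1 : α < 1) (hβ : 2 < β) (b : ℕ → ℕ) (hb : b ∈ Sig α β)
    (x : ℕ → ℕ) (h1 : LoP (Om α β 0) x) (h2 : HiP b x) : x ∈ Sig α β := by
  unfold Sig
  rw [mem_closure_seq]
  intro n
  obtain ⟨y, hy, h⟩ := realize hα0 hα1 hβ b hb n x h1 h2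
  exact ⟨_, ⟨y, hy, rfl⟩, h⟩

lemma a_zero (hα0 : 0 ≤ α) (hα1 : α < 1) : Om α β 0 0 = 0 := by
  have : ⌊α⌋ = 0 := Int.floor_eq_zero_iff.mpr ⟨hα0, hα1⟩
  simp [Om, this]

lemma b_zero (hα0 : 0 ≤ α) (hα1 : α < 1) (hβ : 2 < β) (b : ℕ → ℕ)
    (hbsup : ∀ y ∈ Sig α β, lexLe y b) : 2 ≤ b 0 := by
  obtain ⟨x, hx, h, _⟩ := Om_pre (α := α) (β := β) hα1 hβ 0 (by simp) 2
    (by push_cast; linarith) (by push_cast; linarith)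
  have := Sig_hi b hbsup _ (subset_closure ⟨x, hx, rfl⟩) 0 0 (fun i hi => by omega)
  simp only [Nat.add_zero, h] at this
  exact this

end Dyn

section Comb
variable {a b : ℕ → ℕ} {r : ℕ}

lemma SS_closed : IsClosed (SS a b r) := by
  rw [← closure_subset_iff_isClosed]
  intro x hx
  rw [mem_closure_seq] at hx
  refine ⟨fun m k h => ?_, fun m k h => ?_, fun m => ?_⟩
  · obtain ⟨y, hy, e⟩ := hx (m + k + 1)
    rw [← e (m + k) (by omega)]
    exact hy.1 m k (fun i hi => by rw [e _ (by omega), h i hi])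
  · obtain ⟨y, hy, e⟩ := hx (m + k + 1)
    rw [← e (m + k) (by omega)]
    exact hy.2.1 m k (fun i hi => by rw [e _ (by omega), h i hi])
  · obtain ⟨y, hy, e⟩ := hx (m + r + 1)
    obtain ⟨i, hi, h⟩ := hy.2.2 m
    exact ⟨i, hi, by rwa [← e (m + i) (by omega)]⟩

lemma SS_drop (x : ℕ → ℕ) (hx : x ∈ SS a b r) (n : ℕ) : (fun i => x (n + i)) ∈ SS a b r := by
  refine ⟨fun m k h => ?_, fun m k h => ?_, fun m => ?_⟩
  · have := hx.1 (n + m) k (fun i hi => by rw [Nat.add_assoc]; exact h i hi)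
    rwa [Nat.add_assoc] at this
  · have := hx.2.1 (n + m) k (fun i hi => by rw [Nat.add_assoc]; exact h i hi)
    rwa [Nat.add_assoc] at this
  · obtain ⟨i, hi, h⟩ := hx.2.2 (n + m)
    exact ⟨i, hi, by rwa [Nat.add_assoc] at h⟩

lemma SS_good (x : ℕ → ℕ) (hx : x ∈ SS a b r) (p : ℕ) : GoodP a b r x p :=
  ⟨fun m k _ => hx.1 m k, fun m k _ => hx.2.1 m k, fun m _ => hx.2.2 m⟩

lemma cc_lt (z y : ℕ → ℕ) {p i : ℕ} (h : i < p) : cc z p y i = z i := by simp [cc, h]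

lemma cc_ge (z y : ℕ → ℕ) (p i : ℕ) : cc z p y (p + i) = y i := by simp [cc]

/-- Anything may follow a word in the neutral state. -/
lemma cc_mem (z y : ℕ → ℕ) (p : ℕ) (hz : GoodP a b r z p) (ha : NoM a z p) (hb : NoM b z p)
    (hy : y ∈ SS a b r) : cc z p y ∈ SS a b r := by
  have key : ∀ s, NoM s z p → ∀ m k, m < p → p ≤ m + k →
      ¬ ∀ i < k, cc z p y (m + i) = s i := by
    intro s hs m k hm hk h
    refine hs m hm (fun i hi => ?_)
    rw [← h i (by omega), cc_lt _ _ (by omega)]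
  refine ⟨fun m k h => ?_, fun m k h => ?_, fun m => ?_⟩
  · rcases lt_or_ge m p with hm | hm
    · rcases lt_or_ge (m + k) p with hk | hk
      · rw [cc_lt _ _ hk]
        exact hz.lo m k hk (fun i hi => by rw [← h i hi, cc_lt _ _ (by omega)])
      · exact absurd h (key a ha m k hm hk)
    · obtain ⟨d, rfl⟩ := Nat.exists_eq_add_of_le hm
      rw [Nat.add_assoc, cc_ge]
      exact hy.1 d k (fun i hi => by rw [← h i hi, Nat.add_assoc, cc_ge])
  · rcases lt_or_ge m p with hm | hm
    · rcases lt_or_ge (m + k) p with hk | hk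
      · rw [cc_lt _ _ hk]
        exact hz.hi m k hk (fun i hi => by rw [← h i hi, cc_lt _ _ (by omega)])
      · exact absurd h (key b hb m k hm hk)
    · obtain ⟨d, rfl⟩ := Nat.exists_eq_add_of_le hm
      rw [Nat.add_assoc, cc_ge]
      exact hy.2.1 d k (fun i hi => by rw [← h i hi, Nat.add_assoc, cc_ge])
  · rcases lt_or_ge m p with hm | hm
    · rcases Nat.lt_or_ge p (m + (r + 1)) with hk | hk
      · have := key b hb m (r + 1) hm hk.le
        push Not at this
        exact this
      · obtain ⟨i, hi, h⟩ := hz.no m hk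
        exact ⟨i, hi, by rwa [cc_lt _ _ (by omega)]⟩
    · obtain ⟨d, rfl⟩ := Nat.exists_eq_add_of_le hm
      obtain ⟨i, hi, h⟩ := hy.2.2 d
      exact ⟨i, hi, by rwa [Nat.add_assoc, cc_ge]⟩

lemma one_mem (ha0 : a 0 = 0) (hb0 : 2 ≤ b 0) : (fun _ => 1) ∈ SS a b r := by
  refine ⟨fun m k h => ?_, fun m k h => ?_, fun m => ⟨0, by omega, by simp; omega⟩⟩
  · rcases Nat.eq_zero_or_pos k with rfl | hk
    · simp only; omega
    · have := h 0 hk; simp only at this; omega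
  · rcases Nat.eq_zero_or_pos k with rfl | hk
    · simp only; omega
    · have := h 0 hk; simp only at this; omega

/-- Following `b` up to the flat, then `1`. -/
lemma exit_b (ha0 : a 0 = 0) (hb0 : 2 ≤ b 0) (hbl : LoP a b) (hbh : HiP b b)
    (hK : NoM a b r) (hr : 2 ≤ b r) (z : ℕ → ℕ) (p m : ℕ) (hz : GoodP a b r z p)
    (hm : m < p) (hmb : ∀ i < p - m, z (m + i) = b i)
    (nb : ∀ m' < m, ¬ ∀ i < p - m', z (m' + i) = b i)
    (na : ∀ m' < m, ¬ ∀ i < p - m', z (m' + i) = a i) :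
    ∃ z' q, p ≤ q ∧ q ≤ p + r ∧ (∀ i < p, z' i = z i) ∧ GoodP a b r z' q ∧
      NoM a z' q ∧ NoM b z' q := by
  have hpr : p ≤ m + r := by
    by_contra hc
    obtain ⟨i, hi, h⟩ := hz.no m (by omega)
    exact h (hmb i (by omega))
  set z' : ℕ → ℕ := fun i => if i < p then z i else if i < m + r then b (i - m) else 1 with hz'
  have e1 : ∀ i < p, z' i = z i := fun i hi => by simp [hz', hi]
  have e2 : ∀ i, i < r → z' (m + i) = b i := fun i hi => by
    by_cases h : m + i < p
    · rw [e1 _ h, hmb i (by omega)]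
    · simp only [hz', h, if_false]
      rw [if_pos (by omega)]
      congr 1; omega
  have e3 : z' (m + r) = 1 := by
    simp only [hz']
    rw [if_neg (by omega), if_neg (by omega)]
  have pb : ∀ m' < m, ∀ k, p ≤ m' + k → ¬ ∀ i < k, z' (m' + i) = b i := by
    intro m' h1 k hk h
    exact nb m' h1 (fun i hi => by rw [← h i (by omega), e1 _ (by omega)])
  have pa : ∀ m' < m, ∀ k, p ≤ m' + k → ¬ ∀ i < k, z' (m' + i) = a i := by
    intro m' h1 k hk h
    exact na m' h1 (fun i hi => by rw [← h i (by omega), e1 _ (by omega)])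
  have qa : ∀ d k, d + k = r → 0 < k → ¬ ∀ i < k, z' (m + d + i) = a i := by
    intro d k hd hk h
    refine hK d (by omega) (fun i hi => ?_)
    rw [← h i (by omega), Nat.add_assoc, e2 _ (by omega)]
  have qb : ∀ d k, d + k = r → (∀ i < k, z' (m + d + i) = b i) → 2 ≤ b k := by
    intro d k hd h
    have := hbh d k (fun i hi => by
      rw [← h i hi, Nat.add_assoc, e2 _ (by omega)])
    rw [hd] at this
    omega
  refine ⟨z', m + r + 1, by omega, by omega, e1, ⟨?_, ?_, ?_⟩, ?_, ?_⟩
  · intro m' k hk h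
    rcases lt_or_ge (m' + k) p with h1 | h1
    · rw [e1 _ h1]
      exact hz.lo m' k h1 (fun i hi => by rw [← h i hi, e1 _ (by omega)])
    · rcases lt_or_ge m' m with h2 | h2
      · exact absurd h (pa m' h2 k h1)
      · obtain ⟨d, rfl⟩ := Nat.exists_eq_add_of_le h2
        rcases Nat.lt_or_ge (d + k) r with h3 | h3
        · rw [Nat.add_assoc, e2 _ h3]
          exact hbl d k (fun i hi => by rw [← h i hi, Nat.add_assoc, e2 _ (by omega)])
        · have h4 : d + k = r := by omega
          rcases Nat.eq_zero_or_pos k with rfl | hk0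
          · omega
          · exact absurd h (qa d k h4 hk0)
  · intro m' k hk h
    rcases lt_or_ge (m' + k) p with h1 | h1
    · rw [e1 _ h1]
      exact hz.hi m' k h1 (fun i hi => by rw [← h i hi, e1 _ (by omega)])
    · rcases lt_or_ge m' m with h2 | h2
      · exact absurd h (pb m' h2 k h1)
      · obtain ⟨d, rfl⟩ := Nat.exists_eq_add_of_le h2
        rcases Nat.lt_or_ge (d + k) r with h3 | h3
        · rw [Nat.add_assoc, e2 _ h3]
          exact hbh d k (fun i hi => by rw [← h i hi, Nat.add_assoc, e2 _ (by omega)])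
        · have h4 : d + k = r := by omega
          have := qb d k h4 h
          rw [Nat.add_assoc, h4, e3]
          omega
  · intro m' hm'
    rcases lt_or_ge m' m with h2 | h2
    · rcases Nat.lt_or_ge p (m' + (r + 1)) with h1 | h1
      · have := pb m' h2 (r + 1) h1.le
        push Not at this
        exact this
      · obtain ⟨i, hi, h⟩ := hz.no m' h1
        exact ⟨i, hi, by rwa [e1 _ (by omega)]⟩
    · have : m' = m := by omega
      subst this
      exact ⟨r, by omega, by rw [e3]; omega⟩
  · intro m' hm' h
    rcases lt_or_ge m' m with h2 | h2
    · exact pa m' h2 _ (by omega) h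
    · obtain ⟨d, rfl⟩ := Nat.exists_eq_add_of_le h2
      rcases Nat.lt_or_ge d r with h3 | h3
      · exact qa d (r - d) (by omega) (by omega) (fun i hi => h i (by omega))
      · have : d = r := by omega
        subst this
        have := h 0 (by omega)
        rw [Nat.add_zero, e3] at this
        omega
  · intro m' hm' h
    rcases lt_or_ge m' m with h2 | h2
    · exact pb m' h2 _ (by omega) h
    · obtain ⟨d, rfl⟩ := Nat.exists_eq_add_of_le h2
      have h5 := qb d (r - d) (by omega) (fun i hi => h i (by omega))
      have h6 := h (r - d) (by omega)
      rw [Nat.add_assoc, show d + (r - d) = r by omega, e3] at h6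
      omega

/-- Following `a` for a while, then bumping a letter. -/
lemma exit_a {L : ℕ} (ha0 : a 0 = 0) (hal : LoP a a) (hah : HiP b a) (hbh : HiP b b)
    (hL : ∀ j, ¬ ∀ i < L + 1, b i = a (j + i)) (hLr : L + 1 ≤ r)
    (z : ℕ → ℕ) (p m : ℕ) (hz : GoodP a b r z p)
    (hm : m < p) (hma : ∀ i < p - m, z (m + i) = a i)
    (nb : ∀ m' < m, ¬ ∀ i < p - m', z (m' + i) = b i)
    (na : ∀ m' < m, ¬ ∀ i < p - m', z (m' + i) = a i) :
    ∃ z' q, p ≤ q ∧ q ≤ p + L + 1 ∧ (∀ i < p, z' i = z i) ∧ GoodP a b r z' q ∧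
      NoM a z' q := by
  classical
  -- the position to bump
  obtain ⟨s, hs1, hs2, hs3⟩ : ∃ s, p - m ≤ s ∧ s ≤ p - m + L ∧
      ∀ d ≤ s, (∀ i < s - d, a (d + i) = b i) → a s < b (s - d) := by
    have hex : ∃ d, d ≤ p - m ∧ ∀ i < p - m - d, a (d + i) = b i :=
      ⟨p - m, le_rfl, fun i hi => by omega⟩
    obtain ⟨hd1, hd2⟩ := Nat.find_spec hex
    have hmin := fun j hj => Nat.find_min hex (m := j) hj
    generalize Nat.find hex = d0 at hd1 hd2 hmin
    obtain ⟨k, hk, hk1, hk2⟩ := first_diff b (fun i => a (d0 + i)) (L + 1) (hL d0)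
    have hkp : p - m ≤ d0 + k := by
      by_contra hc
      exact hk2 (hd2 k (by omega)).symm
    refine ⟨d0 + k, hkp, by omega, fun d hd h => ?_⟩
    have hdd : d0 ≤ d := by
      by_contra hc
      exact hmin d (by omega) ⟨by omega, fun i hi => h i (by omega)⟩
    obtain ⟨e, rfl⟩ := Nat.exists_eq_add_of_le hdd
    have h1 := hah d0 k (fun i hi => (hk1 i hi).symm)
    have h2 := hbh e (k - e) (fun i hi => by
      rw [hk1 (e + i) (by omega), ← Nat.add_assoc]
      exact h i (by omega))
    rw [show e + (k - e) = k by omega] at h2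
    rw [show d0 + k - (d0 + e) = k - e by omega]
    omega
  set z' : ℕ → ℕ := fun i => if i < p then z i else if i < m + s then a (i - m) else a s + 1
    with hz'
  have e1 : ∀ i < p, z' i = z i := fun i hi => by simp [hz', hi]
  have e2 : ∀ i, i < s → z' (m + i) = a i := fun i hi => by
    by_cases h : m + i < p
    · rw [e1 _ h, hma i (by omega)]
    · simp only [hz', h, if_false]
      rw [if_pos (by omega)]
      congr 1; omega
  have e3 : z' (m + s) = a s + 1 := by
    simp only [hz']
    rw [if_neg (by omega), if_neg (by omega)]
  have pb : ∀ m' < m, ∀ k, p ≤ m' + k → ¬ ∀ i < k, z' (m' + i) = b i := by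
    intro m' h1 k hk h
    exact nb m' h1 (fun i hi => by rw [← h i (by omega), e1 _ (by omega)])
  have pa : ∀ m' < m, ∀ k, p ≤ m' + k → ¬ ∀ i < k, z' (m' + i) = a i := by
    intro m' h1 k hk h
    exact na m' h1 (fun i hi => by rw [← h i (by omega), e1 _ (by omega)])
  have qa : ∀ d k, d + k = s → (∀ i < k, z' (m + d + i) = a i) → a k ≤ a s := by
    intro d k hd h
    have := hal d k (fun i hi => by rw [← h i hi, Nat.add_assoc, e2 _ (by omega)])
    rwa [hd] at this
  refine ⟨z', m + s + 1, by omega, by omega, e1, ⟨?_, ?_, ?_⟩, ?_⟩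
  · intro m' k hk h
    rcases lt_or_ge (m' + k) p with h1 | h1
    · rw [e1 _ h1]
      exact hz.lo m' k h1 (fun i hi => by rw [← h i hi, e1 _ (by omega)])
    · rcases lt_or_ge m' m with h2 | h2
      · exact absurd h (pa m' h2 k h1)
      · obtain ⟨d, rfl⟩ := Nat.exists_eq_add_of_le h2
        rcases Nat.lt_or_ge (d + k) s with h3 | h3
        · rw [Nat.add_assoc, e2 _ h3]
          exact hal d k (fun i hi => by rw [← h i hi, Nat.add_assoc, e2 _ (by omega)])
        · have h4 : d + k = s := by omega
          have := qa d k h4 h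
          rw [Nat.add_assoc, h4, e3]
          omega
  · intro m' k hk h
    rcases lt_or_ge (m' + k) p with h1 | h1
    · rw [e1 _ h1]
      exact hz.hi m' k h1 (fun i hi => by rw [← h i hi, e1 _ (by omega)])
    · rcases lt_or_ge m' m with h2 | h2
      · exact absurd h (pb m' h2 k h1)
      · obtain ⟨d, rfl⟩ := Nat.exists_eq_add_of_le h2
        rcases Nat.lt_or_ge (d + k) s with h3 | h3
        · rw [Nat.add_assoc, e2 _ h3]
          exact hah d k (fun i hi => by rw [← h i hi, Nat.add_assoc, e2 _ (by omega)])
        · have h4 : d + k = s := by omega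
          have := hs3 d (by omega) (fun i hi => by
            rw [← h i (by omega), Nat.add_assoc, e2 _ (by omega)])
          rw [show s - d = k by omega] at this
          rw [Nat.add_assoc, h4, e3]
          omega
  · intro m' hm'
    rcases Nat.lt_or_ge p (m' + (r + 1)) with h1 | h1
    · by_contra hc
      push Not at hc
      rcases lt_or_ge m' m with h2 | h2
      · exact pb m' h2 (r + 1) h1.le hc
      · obtain ⟨d, rfl⟩ := Nat.exists_eq_add_of_le h2
        exact hL d (fun i hi => by
          rw [← hc i (by omega), Nat.add_assoc, e2 _ (by omega)])
    · obtain ⟨i, hi, h⟩ := hz.no m' h1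
      exact ⟨i, hi, by rwa [e1 _ (by omega)]⟩
  · intro m' hm' h
    rcases lt_or_ge m' m with h2 | h2
    · exact pa m' h2 _ (by omega) h
    · obtain ⟨d, rfl⟩ := Nat.exists_eq_add_of_le h2
      have h5 := qa d (s - d) (by omega) (fun i hi => h i (by omega))
      have h6 := h (s - d) (by omega)
      rw [Nat.add_assoc, show d + (s - d) = s by omega, e3] at h6
      omega

lemma exit_all {L : ℕ} (ha0 : a 0 = 0) (hb0 : 2 ≤ b 0) (hal : LoP a a) (hah : HiP b a)
    (hbl : LoP a b) (hbh : HiP b b)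
    (hL : ∀ j, ¬ ∀ i < L + 1, b i = a (j + i)) (hLr : L + 1 ≤ r)
    (hK : NoM a b r) (hr : 2 ≤ b r) (z : ℕ → ℕ) (p : ℕ) (hz : GoodP a b r z p) :
    ∃ z' q, p ≤ q ∧ q ≤ p + (L + 1 + r) ∧ (∀ i < p, z' i = z i) ∧ GoodP a b r z' q ∧
      NoM a z' q ∧ NoM b z' q := by
  classical
  -- the case without `a`-matches
  have step : ∀ z p, GoodP a b r z p → NoM a z p →
      ∃ z' q, p ≤ q ∧ q ≤ p + r ∧ (∀ i < p, z' i = z i) ∧ GoodP a b r z' q ∧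
      NoM a z' q ∧ NoM b z' q := by
    intro z p hz hna
    by_cases hnb : NoM b z p
    · exact ⟨z, p, le_rfl, by omega, fun _ _ => rfl, hz, hna, hnb⟩
    · have hex : ∃ m, m < p ∧ ∀ i < p - m, z (m + i) = b i := by
        unfold NoM at hnb
        push Not at hnb
        exact hnb
      obtain ⟨h1, h2⟩ := Nat.find_spec hex
      exact exit_b ha0 hb0 hbl hbh hK hr z p _ hz h1 h2
        (fun m' hm' h => Nat.find_min hex hm' ⟨by omega, h⟩)
        (fun m' hm' => hna m' (by omega))
  by_cases hna : NoM a z p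
  · obtain ⟨z', q, h1, h2, h3⟩ := step z p hz hna
    exact ⟨z', q, h1, by omega, h3⟩
  · have hex : ∃ m, m < p ∧ ((∀ i < p - m, z (m + i) = a i) ∨ (∀ i < p - m, z (m + i) = b i)) := by
      unfold NoM at hna
      push Not at hna
      obtain ⟨m, h1, h2⟩ := hna
      exact ⟨m, h1, Or.inl h2⟩
    obtain ⟨h1, h2⟩ := Nat.find_spec hex
    have nb : ∀ m' < Nat.find hex, ¬ ∀ i < p - m', z (m' + i) = b i :=
      fun m' hm' h => Nat.find_min hex hm' ⟨by omega, Or.inr h⟩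
    have na : ∀ m' < Nat.find hex, ¬ ∀ i < p - m', z (m' + i) = a i :=
      fun m' hm' h => Nat.find_min hex hm' ⟨by omega, Or.inl h⟩
    rcases h2 with h2 | h2
    · obtain ⟨z1, q1, g1, g2, g3, g4, g5⟩ :=
        exit_a ha0 hal hah hbh hL hLr z p _ hz h1 h2 nb na
      obtain ⟨z', q, k1, k2, k3, k4⟩ := step z1 q1 g4 g5
      exact ⟨z', q, by omega, by omega, fun i hi => by rw [k3 i (by omega), g3 i hi], k4⟩
    · obtain ⟨z', q, k1, k2, k3⟩ := exit_b ha0 hb0 hbl hbh hK hr z p _ hz h1 h2 nb na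
      exact ⟨z', q, k1, by omega, k3⟩

lemma exit_pad {L : ℕ} (ha0 : a 0 = 0) (hb0 : 2 ≤ b 0) (hal : LoP a a) (hah : HiP b a)
    (hbl : LoP a b) (hbh : HiP b b)
    (hL : ∀ j, ¬ ∀ i < L + 1, b i = a (j + i)) (hLr : L + 1 ≤ r)
    (hK : NoM a b r) (hr : 2 ≤ b r) (z : ℕ → ℕ) (p : ℕ) (hz : z ∈ SS a b r) :
    ∃ z', (∀ i < p, z' i = z i) ∧ ∀ y ∈ SS a b r, cc z' (p + (L + 1 + r)) y ∈ SS a b r := by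
  obtain ⟨z1, q, h1, h2, h3, h4, h5, h6⟩ :=
    exit_all ha0 hb0 hal hah hbl hbh hL hLr hK hr z p (SS_good z hz p)
  have hm := cc_mem z1 _ q h4 h5 h6 (one_mem (r := r) ha0 hb0)
  have nom : ∀ s, s 0 ≠ 1 → NoM s z1 q → NoM s (cc z1 q (fun _ => 1)) (p + (L + 1 + r)) := by
    intro s hs hN m hmp h
    rcases lt_or_ge m q with hq | hq
    · exact hN m hq (fun i hi => by rw [← h i (by omega), cc_lt _ _ (by omega)])
    · obtain ⟨d, rfl⟩ := Nat.exists_eq_add_of_le hq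
      have := h 0 (by omega)
      rw [Nat.add_zero, cc_ge] at this
      exact hs this.symm
  refine ⟨cc z1 q (fun _ => 1), fun i hi => by rw [cc_lt _ _ (by omega), h3 i hi], fun y hy => ?_⟩
  exact cc_mem _ y _ (SS_good _ hm _) (nom a (by omega) h5) (nom b (by omega) h6) hy

lemma wcat_append (u v : List ℕ) (y : ℕ → ℕ) : wcat (u ++ v) y = wcat u (wcat v y) := by
  funext n
  unfold wcat
  by_cases h1 : n < u.length
  · simp [h1, show n < u.length + v.length by omega]
  · by_cases h2 : n < u.length + v.length
    · have h3 : n - u.length < v.length := by omega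
      simp [h1, h2, h3, List.getElem_append_right (show u.length ≤ n by omega)]
    · have h3 : ¬ n - u.length < v.length := by omega
      simp only [List.length_append, h1, h2, h3, dif_neg, not_false_eq_true]
      congr 1; omega

lemma langOf_iff (S : Set (ℕ → ℕ)) (w : List ℕ) : langOf S w ↔ ∃ y, wcat w y ∈ S := by
  constructor
  · rintro ⟨x, hx, h⟩
    refine ⟨fun i => x (w.length + i), ?_⟩
    convert hx
    funext n
    unfold wcat
    split_ifs with hn
    · exact (h ⟨n, hn⟩).symm
    · change x (w.length + (n - w.length)) = x n
      congr 1; omega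
  · rintro ⟨y, hy⟩
    exact ⟨_, hy, fun i => by simp [wcat]⟩

lemma wcat_flatten (S : Set (ℕ → ℕ)) (ws : List (List ℕ))
    (h : ∀ u ∈ ws, ∀ y ∈ S, wcat u y ∈ S) (y : ℕ → ℕ) (hy : y ∈ S) :
    wcat ws.flatten y ∈ S := by
  induction ws with
  | nil =>
    have e : wcat ([] : List (List ℕ)).flatten y = y := by funext n; simp [wcat]
    rw [e]; exact hy
  | cons u ws ih =>
    rw [List.flatten_cons, wcat_append]
    exact h u (by simp) _ (ih (fun u' hu' => h u' (by simp [hu'])))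

lemma SS_wdrop (u : List ℕ) (y : ℕ → ℕ) (h : wcat u y ∈ SS a b r) : y ∈ SS a b r := by
  have := SS_drop _ h u.length
  convert this using 1
  funext i
  simp [wcat]

lemma SS_spec {L : ℕ} (ha0 : a 0 = 0) (hb0 : 2 ≤ b 0) (hal : LoP a a) (hah : HiP b a)
    (hbl : LoP a b) (hbh : HiP b b)
    (hL : ∀ j, ¬ ∀ i < L + 1, b i = a (j + i)) (hLr : L + 1 ≤ r)
    (hK : NoM a b r) (hr : 2 ≤ b r) : HasSpec (langOf (SS a b r)) (langOf (SS a b r)) := by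
  refine ⟨L + 1 + r, by omega, fun n w hw => ?_⟩
  have one : ∀ w, langOf (SS a b r) w → ∃ v : List ℕ, v.length = L + 1 + r ∧
      ∀ y ∈ SS a b r, wcat (w ++ v) y ∈ SS a b r := by
    rintro w ⟨x, hx, hxw⟩
    obtain ⟨z, hz1, hz2⟩ := exit_pad ha0 hb0 hal hah hbl hbh hL hLr hK hr x w.length hx
    refine ⟨List.ofFn fun i : Fin (L + 1 + r) => z (w.length + i), by simp, fun y hy => ?_⟩
    convert hz2 y hy using 1
    funext i
    unfold wcat cc
    by_cases h1 : i < w.length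
    · rw [dif_pos (by simp; omega), if_pos (by omega), hz1 i h1, hxw ⟨i, h1⟩]
      simp [List.getElem_append_left h1]
    · by_cases h2 : i < w.length + (L + 1 + r)
      · rw [dif_pos (by simp; omega), if_pos h2]
        simp [List.getElem_append_right (show w.length ≤ i by omega),
          show w.length + (i - w.length) = i by omega]
      · rw [dif_neg (by simp; omega), if_neg h2]
        simp
  choose v hv1 hv2 using fun i : Fin n => one (w i.castSucc) (hw _)
  refine ⟨v, fun i => ⟨hv1 i, ?_⟩, ?_⟩
  · rw [langOf_iff]
    refine ⟨fun _ => 1, ?_⟩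
    have := hv2 i _ (one_mem ha0 hb0)
    rw [wcat_append] at this
    exact SS_wdrop _ _ this
  · rw [langOf_iff]
    obtain ⟨y, hy⟩ := (langOf_iff _ _).1 (hw (Fin.last n))
    refine ⟨y, ?_⟩
    unfold glue
    rw [wcat_append]
    refine wcat_flatten _ _ ?_ _ hy
    intro u hu y hy
    rw [List.mem_ofFn] at hu
    obtain ⟨i, rfl⟩ := hu
    exact hv2 i y hy

lemma kmax_zero (s x : ℕ → ℕ) (n : ℕ) : kmax s (pre x n) = 0 ↔ NoM s x n := by
  have hbdd : BddAbove {k | tailAgrees s (pre x n) k} := ⟨n, fun k hk => by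
    have := hk.1; simpa [pre] using this⟩
  have hiff : ∀ k, tailAgrees s (pre x n) k ↔ k ≤ n ∧ ∀ i < k, x (n - k + i) = s i := by
    intro k
    unfold tailAgrees
    simp only [pre, List.length_ofFn]
    refine and_congr_right fun hk => forall₂_congr fun i hi => ?_
    have : n - k + i < n := by omega
    simp [List.getD_eq_getElem?_getD, this]
  constructor
  · intro h m hm hma
    have : n - m ≤ kmax s (pre x n) := le_csSup hbdd ((hiff _).2 ⟨by omega, fun i hi => by
      rw [show n - (n - m) = m by omega]; exact hma i hi⟩)
    omega
  · intro h
    have hne : {k | tailAgrees s (pre x n) k}.Nonempty := ⟨0, (hiff 0).2 ⟨by omega, by simp⟩⟩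
    have := Nat.sSup_mem hne hbdd
    by_contra hc
    obtain ⟨h1, h2⟩ := (hiff _).1 this
    unfold kmax at hc
    refine h (n - sSup {k | tailAgrees s (pre x n) k}) (by omega) (fun i hi => h2 i (by omega))

lemma c_mem {L : ℕ} (ha0 : a 0 = 0)
    (hbl : LoP a b) (hbh : HiP b b)
    (hL : ∀ j, ¬ ∀ i < L + 1, b i = a (j + i)) (hLr : L + 1 ≤ r)
    (hK : NoM a b r) (hK' : NoM a b (r + 1)) (hr : 2 ≤ b r) : cseq a b ∈ SS a b r := by
  have c1 : ∀ i, NoM a b i → NoM a b (i + 1) → cseq a b i = 1 := fun i h1 h2 => by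
    simp [cseq, kmax_zero, h1, h2]
  have c2 : ∀ i, ¬ (NoM a b i ∧ NoM a b (i + 1)) → cseq a b i = b i := fun i h => by
    rw [← kmax_zero, ← kmax_zero] at h
    unfold cseq
    rw [if_neg h]
  have cle : ∀ i, cseq a b i ≤ b i := by
    intro i
    by_cases h : NoM a b i ∧ NoM a b (i + 1)
    · rw [c1 i h.1 h.2]
      by_contra hc
      refine h.2 i (by omega) (fun j hj => ?_)
      have : j = 0 := by omega
      subst this
      simp only [Nat.add_zero]
      omega
    · rw [c2 i h]
  have upb : ∀ m k, (∀ i < k, cseq a b (m + i) = b i) → ∀ j ≤ k, ∀ i < j, b (m + i) = b i := by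
    intro m k h j
    induction j with
    | zero => intro _ i hi; omega
    | succ j ih =>
      intro hj i hi
      rcases Nat.lt_or_ge i j with h1 | h1
      · exact ih (by omega) i h1
      · have : i = j := by omega
        subst this
        have g1 := hbh m i (ih (by omega))
        have g2 := cle (m + i)
        have g3 := h i (by omega)
        omega
  refine ⟨fun m k h => ?_, fun m k h => ?_, fun m => ?_⟩
  · have upa : ∀ j ≤ k, ∀ i < j, b (m + i) = a i := by
      intro j
      induction j with
      | zero => intro _ i hi; omega
      | succ j ih =>
        intro hj i hi
        rcases Nat.lt_or_ge i j with h1 | h1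
        · exact ih (by omega) i h1
        · have : i = j := by omega
          subst this
          rw [← h i (by omega)]
          by_cases hf : NoM a b (m + i) ∧ NoM a b (m + i + 1)
          · exfalso
            rcases Nat.eq_zero_or_pos i with rfl | h0
            · have g := h 0 (by omega)
              rw [c1 _ hf.1 hf.2] at g
              omega
            · exact hf.1 m (by omega) (fun t ht => ih (by omega) t (by omega))
          · rw [c2 _ hf]
    by_cases hf : NoM a b (m + k) ∧ NoM a b (m + k + 1)
    · rcases Nat.eq_zero_or_pos k with rfl | h0
      · omega
      · exact absurd (fun t ht => upa k le_rfl t (by omega)) (hf.1 m (by omega))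
    · rw [c2 _ hf]
      exact hbl m k (upa k le_rfl)
  · exact (cle _).trans (hbh m k (upb m k h k le_rfl))
  · by_contra hc
    push Not at hc
    have hb' := upb m (r + 1) hc (r + 1) le_rfl
    -- no `a`-match in `b` ends at `m + t` for `t = r, r + 1`
    have key : ∀ t, r ≤ t → t ≤ r + 1 → NoM a b t → NoM a b (m + t) := by
      intro t h1 h2 hN m' hm' h
      rcases lt_or_ge m' m with g | g
      · refine hL (m - m') (fun i hi => ?_)
        rw [← h (m - m' + i) (by omega), ← hb' i (by omega)]
        congr 1; omega
      · obtain ⟨d, rfl⟩ := Nat.exists_eq_add_of_le g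
        refine hN d (by omega) (fun i hi => ?_)
        rw [← h i (by omega), ← hb' (d + i) (by omega), Nat.add_assoc]
    have e := c1 (m + r) (key r le_rfl (by omega) hK) (key (r + 1) (by omega) le_rfl hK')
    have := hc r (by omega)
    omega

end Comb

/-- **Lemma.** For `0 ≤ α < 1` and `β > 2` with `L = max 𝖣(a)`: either `c`
belongs to a closed shift-invariant subset `Σ' ⊆ Σ` whose language has
specification, or `b_i = c_i` for all `i > L + 1`. -/
theorem cseq_spec_or_eventually_eq (α β : ℝ) (hα0 : 0 ≤ α) (hα1 : α < 1)
    (hβ : 2 < β) (b : ℕ → ℕ) (hb : b ∈ Sig α β) (hbsup : ∀ y ∈ Sig α β, lexLe y b)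
    (L : ℕ) (hLmem : L ∈ D (Om α β 0) b) (hLub : ∀ n ∈ D (Om α β 0) b, n ≤ L) :
    (∃ S' : Set (ℕ → ℕ), S' ⊆ Sig α β ∧ IsClosed S' ∧ (∀ y ∈ S', shift y ∈ S') ∧
        cseq (Om α β 0) b ∈ S' ∧ HasSpec (langOf S') (langOf S')) ∨
      (∀ i : ℕ, L + 1 ≤ i → b i = cseq (Om α β 0) b i) := by
  set a := Om α β 0 with ha
  have ha0 : a 0 = 0 := a_zero hα0 hα1
  have hb0 : 2 ≤ b 0 := b_zero hα0 hα1 hβ b hbsup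
  have haS : a ∈ Sig α β := subset_closure ⟨0, by simp, rfl⟩
  have hal : LoP a a := Sig_lo hα0 hβ a haS
  have hah : HiP b a := Sig_hi b hbsup a haS
  have hbl : LoP a b := Sig_lo hα0 hβ b hb
  have hbh : HiP b b := Sig_hi b hbsup b hb
  have hL : ∀ j, ¬ ∀ i < L + 1, b i = a (j + i) := fun j h => by
    have := hLub (L + 1) ⟨j, h⟩
    omega
  by_cases hall : ∀ i : ℕ, L + 1 ≤ i → b i = cseq a b i
  · exact Or.inr hall
  left
  push Not at hall
  obtain ⟨r, hLr, hne⟩ := hall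
  have hfl : NoM a b r ∧ NoM a b (r + 1) := by
    by_contra hc
    apply hne
    rw [← kmax_zero, ← kmax_zero] at hc
    unfold cseq
    rw [if_neg hc]
  have hr : 2 ≤ b r := by
    have h1 : cseq a b r = 1 := by simp [cseq, kmax_zero, hfl.1, hfl.2]
    have h0 : b r ≠ 0 := fun h => hfl.2 r (by omega) (fun j hj => by
      have : j = 0 := by omega
      subst this
      simp only [Nat.add_zero]
      omega)
    omega
  refine ⟨SS a b r, fun x hx => mem_Sig hα0 hα1 hβ b hb x hx.1 hx.2.1, SS_closed, ?_,
    c_mem ha0 hbl hbh hL hLr hfl.1 hfl.2 hr,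
    SS_spec ha0 hb0 hal hah hbl hbh hL hLr hfl.1 hr⟩
  intro y hy
  have := SS_drop y hy 1
  convert this using 1
  funext i
  simp [shift, Nat.add_comm]

end IntermediateBeta
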